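/- arXiv:1712.05871 — 2 statements merged into one kernel-verified Lean document; each statement's English description precedes it below -/
import Mathlib

section
/- Level-set interpolation: Suppose f : ℝ^n → ℝ is continuous, m ≥ 1, and a_0 < a_1 < ⋯ < a_m are real numbers such that each level set Γ_{a_i} = {x ∈ ℝ^n : f(x) = a_i} is nonempty and compact. Let δ_0 = min{ dist(Γ_{a_i}, Γ_{a_j}) : 0 ≤ i, j ≤ m, i ≠ j } > 0, K = ∪_{i=0}^m Γ_{a_i}, and d_K = diam(K). If λ > (a_m − a_0)/δ_0² and M > λ d_K² + max_K |f|, then for every i ∈ {0,1,…,m} and every x_0 ∈ Γ_{a_i}, the average approximation satisfies A^M_λ(f_K)(x_0) = a_i. -/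
open Metric Set

variable {E : Type*}

/-- Convex envelope of `g`: the pointwise supremum of all affine functions lying below `g`. -/
noncomputable def convEnv [NormedAddCommGroup E] [NormedSpace ℝ E]
    (g : E → ℝ) (x : E) : ℝ :=
  sSup {v : ℝ | ∃ l : E →ᵃ[ℝ] ℝ, (∀ y, l y ≤ g y) ∧ v = l x}

/-- Lower compensated convex transform `C^l_λ(f)`. -/
noncomputable def lowerTransform [NormedAddCommGroup E] [NormedSpace ℝ E]
    (lam : ℝ) (f : E → ℝ) (x : E) : ℝ :=
  convEnv (fun y => lam * ‖y‖ ^ 2 + f y) x - lam * ‖x‖ ^ 2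

/-- Upper compensated convex transform `C^u_λ(f)`. -/
noncomputable def upperTransform [NormedAddCommGroup E] [NormedSpace ℝ E]
    (lam : ℝ) (f : E → ℝ) (x : E) : ℝ :=
  lam * ‖x‖ ^ 2 - convEnv (fun y => lam * ‖y‖ ^ 2 - f y) x

open Classical in
/-- `extendBy f K M` is the function equal to `f` on `K` and to the constant `M` off `K`. -/
noncomputable def extendBy (f : E → ℝ) (K : Set E) (M : ℝ) (x : E) : ℝ :=
  if x ∈ K then f x else M

/-- Average compensated convex approximation `A^M_λ(f_K)`. -/
noncomputable def avgApprox [NormedAddCommGroup E] [NormedSpace ℝ E]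
    (lam M : ℝ) (f : E → ℝ) (K : Set E) (x : E) : ℝ :=
  (lowerTransform lam (extendBy f K M) x + upperTransform lam (extendBy f K (-M)) x) / 2

/-- The convex envelope agrees with `g` wherever `g` has a supporting affine function. -/
theorem convEnv_eq_of_affine [NormedAddCommGroup E] [NormedSpace ℝ E] {g : E → ℝ} {x : E}
    (l : E →ᵃ[ℝ] ℝ) (hl : ∀ y, l y ≤ g y) (hx : l x = g x) : convEnv g x = g x := by
  refine IsGreatest.csSup_eq ⟨⟨l, hl, hx.symm⟩, ?_⟩
  rintro v ⟨k, hk, rfl⟩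
  exact hk x

/-- The lower transform is exact at `x` if `f` lies above the downward parabola of curvature `lam`
with vertex `(x, f x)`. -/
theorem lowerTransform_eq_self [NormedAddCommGroup E] [InnerProductSpace ℝ E] {lam : ℝ}
    {f : E → ℝ} {x : E} (h : ∀ y, f x ≤ lam * ‖y - x‖ ^ 2 + f y) :
    lowerTransform lam f x = f x := by
  let l : E →ᵃ[ℝ] ℝ := ((2 * lam) • (innerSL ℝ x : E →ₗ[ℝ] ℝ)).toAffineMap +
    AffineMap.const ℝ E (f x - lam * ‖x‖ ^ 2)
  have hl (y : E) : l y = 2 * lam * inner ℝ x y + (f x - lam * ‖x‖ ^ 2) := by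
    simp [l]
  unfold lowerTransform
  rw [convEnv_eq_of_affine l]
  · ring
  · intro y
    have hy := h y
    rw [norm_sub_sq_real, real_inner_comm] at hy
    rw [hl]
    linarith
  · rw [hl, real_inner_self_eq_norm_sq]
    ring

theorem upperTransform_eq_neg_lowerTransform [NormedAddCommGroup E] [NormedSpace ℝ E] (lam : ℝ)
    (f : E → ℝ) (x : E) : upperTransform lam f x = -lowerTransform lam (fun y => -f y) x := by
  simp only [upperTransform, lowerTransform, sub_eq_add_neg, neg_add_rev, neg_neg]

/-- The upper transform is exact at `x` if `f` lies below the upward parabola of curvature `lam`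
with vertex `(x, f x)`. -/
theorem upperTransform_eq_self [NormedAddCommGroup E] [InnerProductSpace ℝ E] {lam : ℝ}
    {f : E → ℝ} {x : E} (h : ∀ y, f y ≤ lam * ‖y - x‖ ^ 2 + f x) :
    upperTransform lam f x = f x := by
  rw [upperTransform_eq_neg_lowerTransform, lowerTransform_eq_self, neg_neg]
  intro y
  linarith [h y]

/-- The average approximation interpolates at `x ∈ K` if the values of `f` on `K` differ from `f x`
by at most `lam` times the squared distance to `x`, and `|f x| ≤ M`. -/
theorem avgApprox_eq_self [NormedAddCommGroup E] [InnerProductSpace ℝ E] {lam M : ℝ}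
    {f : E → ℝ} {K : Set E} {x : E} (hlam : 0 ≤ lam) (hx : x ∈ K) (hM : |f x| ≤ M)
    (h : ∀ y ∈ K, |f y - f x| ≤ lam * ‖y - x‖ ^ 2) :
    avgApprox lam M f K x = f x := by
  have hext (c : ℝ) : extendBy f K c x = f x := if_pos hx
  have hM' := abs_le.1 hM
  have hpos (y : E) : 0 ≤ lam * ‖y - x‖ ^ 2 := by positivity
  unfold avgApprox
  rw [lowerTransform_eq_self, upperTransform_eq_self, hext, hext]
  · ring
  all_goals
    intro y
    rw [hext]
    unfold extendBy
    split_ifs with hy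
    · linarith [abs_le.1 (h y hy)]
    · linarith [hpos y]

/-- **Level-set interpolation.** Suppose `f : ℝ^n → ℝ` is continuous, `m ≥ 1`, and
`a 0 < a 1 < ⋯ < a m` are such that each level set `Γ_{a i} = {x | f x = a i}` is nonempty and
compact.  Let `δ₀` be the minimal distance between two distinct level sets, `K` the union of the
level sets and `d_K = diam K`.  If `λ > (a m − a 0)/δ₀²` and `M > λ d_K² + max_K |f|`, then for
every `i` and every `x₀ ∈ Γ_{a i}` one has `A^M_λ(f_K)(x₀) = a i`. -/
theorem level_set_interpolation {n : ℕ} (f : EuclideanSpace ℝ (Fin n) → ℝ)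
    (hf : Continuous f) (m : ℕ) (hm : 1 ≤ m) (a : Fin (m + 1) → ℝ) (ha : StrictMono a)
    (hΓne : ∀ i : Fin (m + 1), {x : EuclideanSpace ℝ (Fin n) | f x = a i}.Nonempty)
    (hΓcpt : ∀ i : Fin (m + 1), IsCompact {x : EuclideanSpace ℝ (Fin n) | f x = a i})
    (δ0 : ℝ)
    (hδ0 : δ0 = sInf {d : ℝ | ∃ i j : Fin (m + 1), i ≠ j ∧
      ∃ x ∈ {x : EuclideanSpace ℝ (Fin n) | f x = a i},
      ∃ y ∈ {y : EuclideanSpace ℝ (Fin n) | f y = a j}, d = dist x y})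
    (hδ0pos : 0 < δ0)
    (K : Set (EuclideanSpace ℝ (Fin n)))
    (hK : K = ⋃ i : Fin (m + 1), {x : EuclideanSpace ℝ (Fin n) | f x = a i})
    (lam M : ℝ)
    (hlam : (a (Fin.last m) - a 0) / δ0 ^ 2 < lam)
    (hM : lam * Metric.diam K ^ 2 + sSup ((fun x => |f x|) '' K) < M) :
    ∀ i : Fin (m + 1), ∀ x0 ∈ {x : EuclideanSpace ℝ (Fin n) | f x = a i},
      avgApprox lam M f K x0 = a i := by
  intro i x hx
  have hxi : f x = a i := hx
  have hmono (k : Fin (m + 1)) : a 0 ≤ a k ∧ a k ≤ a (Fin.last m) :=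
    ⟨ha.monotone (Fin.zero_le k), ha.monotone (Fin.le_last k)⟩
  have hlam0 : 0 ≤ lam :=
    (div_nonneg (sub_nonneg.2 (hmono 0).2) (sq_nonneg δ0)).trans hlam.le
  have hxK : x ∈ K := hK ▸ mem_iUnion.2 ⟨i, hx⟩
  have hKcpt : IsCompact K := hK ▸ isCompact_iUnion hΓcpt
  have hsup : |f x| ≤ sSup ((fun x => |f x|) '' K) :=
    le_csSup (hKcpt.image hf.abs).bddAbove (mem_image_of_mem _ hxK)
  have hdiam : 0 ≤ lam * Metric.diam K ^ 2 := by positivity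
  rw [← hxi]
  refine avgApprox_eq_self hlam0 hxK (by linarith) fun y hy => ?_
  rw [hK] at hy
  obtain ⟨j, hj⟩ := mem_iUnion.1 hy
  have hyj : f y = a j := hj
  rw [hxi, hyj]
  rcases eq_or_ne j i with rfl | hji
  · rw [sub_self, abs_zero]
    positivity
  · have hdist : δ0 ≤ ‖y - x‖ := by
      rw [hδ0, ← dist_eq_norm]
      refine csInf_le ⟨0, ?_⟩ ⟨j, i, hji, y, hj, x, hx, rfl⟩
      rintro _ ⟨_, _, _, _, _, _, _, rfl⟩
      exact dist_nonneg
    calc |a j - a i| ≤ a (Fin.last m) - a 0 := by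
          rw [abs_le]
          constructor <;> linarith [hmono i, hmono j]
      _ ≤ lam * δ0 ^ 2 := ((div_lt_iff₀ (by positivity)).1 hlam).le
      _ ≤ lam * ‖y - x‖ ^ 2 := by gcongr
end

section
/- Inpainting error estimate (uniformly continuous case): Let Λ ⊂ ℝ^n be convex and compact, Ω ⊂ Λ a nonempty open set, and K = Λ ∖ Ω. Let f : Λ → ℝ be bounded and uniformly continuous, and let f̃ : ℝ^n → ℝ be a bounded uniformly continuous extension of f with |f̃(x)| ≤ A_0 for all x ∈ ℝ^n, and f̃ = c_0 (a constant) outside the open ball B(0, r), where r > 0 and K ⊂ B(0, r). For R > r set K_R = K ∪ (ℝ^n ∖ B(0, R)). Let ω : [0,∞) → [0,∞) be concave, nondecreasing, with ω(0) = 0, |f̃(x) − f̃(y)| ≤ ω(|x−y|) for all x, y ∈ ℝ^n, and ω(t) ≤ a t + b for all t ≥ 0, with constants a ≥ 0, b ≥ 0. Then for every λ > 0, every M > A_0 + λ(R + r)², and every x ∈ co[K]: |A^M_λ(f̃_{K_R})(x) − f̃(x)| ≤ ω( r_c(x) + a/λ + √(2b/λ) ), where r_c(x) is the convex density radius of x with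 respect to K. -/
open Metric Set

variable {E : Type*}

/-- Convex density radius `r_c(x)` of a point `x` with respect to a set `K`. -/
noncomputable def convexDensityRadius [NormedAddCommGroup E] [NormedSpace ℝ E]
    (K : Set E) (x : E) : ℝ :=
  sInf {r : ℝ | 0 ≤ r ∧ x ∈ convexHull ℝ (Metric.closedBall x r ∩ K)}

section ConvexEnvelope

variable [NormedAddCommGroup E] [NormedSpace ℝ E]

lemma bddAbove_affine_minorants (g : E → ℝ) (x : E) :
    BddAbove {v : ℝ | ∃ l : E →ᵃ[ℝ] ℝ, (∀ y, l y ≤ g y) ∧ v = l x} :=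
  ⟨g x, by rintro v ⟨l, hl, rfl⟩; exact hl x⟩

lemma affine_le_of_mem_convexHull_epigraph {g : E → ℝ} {S : Set E} {l : E →ᵃ[ℝ] ℝ}
    (hl : ∀ y ∈ S, l y ≤ g y) {p : E × ℝ}
    (hp : p ∈ convexHull ℝ {q : E × ℝ | q.1 ∈ S ∧ g q.1 ≤ q.2}) : l p.1 ≤ p.2 := by
  have hconv : Convex ℝ {q : E × ℝ | l q.1 ≤ q.2} := by
    intro p hp q hq α β hα hβ hαβ
    have h : l (α • p.1 + β • q.1) = α * l p.1 + β * l q.1 :=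
      Convex.combo_affine_apply hαβ
    simp only [mem_ofPred_eq, Prod.fst_add, Prod.snd_add, Prod.smul_fst, Prod.smul_snd,
      smul_eq_mul] at hp hq ⊢
    rw [h]
    gcongr
  exact convexHull_min (fun q hq => (hl _ hq.1).trans hq.2) hconv hp

/-- Points of the convex hull of the epigraph lie above the convex envelope. -/
lemma convEnv_le_of_mem_convexHull {g : E → ℝ} {c : ℝ} (hc : ∀ y, c ≤ g y) {S : Set E}
    {x : E} {s : ℝ} (hxs : (x, s) ∈ convexHull ℝ {q : E × ℝ | q.1 ∈ S ∧ g q.1 ≤ q.2}) :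
    convEnv g x ≤ s := by
  refine csSup_le ⟨c, AffineMap.const ℝ E c, hc, rfl⟩ ?_
  rintro v ⟨l, hl, rfl⟩
  exact affine_le_of_mem_convexHull_epigraph (fun y _ => hl y) hxs

lemma convEnv_le_sum {g : E → ℝ} {c : ℝ} (hc : ∀ y, c ≤ g y) {ι : Type} [Fintype ι]
    {w : ι → ℝ} {z : ι → E} (hw₀ : ∀ i, 0 ≤ w i) (hw₁ : ∑ i, w i = 1) :
    convEnv g (∑ i, w i • z i) ≤ ∑ i, w i * g (z i) := by
  refine convEnv_le_of_mem_convexHull (S := univ) hc ?_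
  refine mem_convexHull_of_exists_fintype w (fun i => (z i, g (z i))) hw₀ hw₁ (by simp) ?_
  ext <;> simp [Prod.fst_sum, Prod.snd_sum]

/-- In finite dimension, the convex envelope is approximated by the convex hull of the epigraph. -/
lemma exists_mem_convexHull_lt_convEnv_add [FiniteDimensional ℝ E] {g : E → ℝ} {c : ℝ}
    (hc : ∀ y, c ≤ g y) (x : E) {ε : ℝ} (hε : 0 < ε) :
    ∃ s < convEnv g x + ε, (x, s) ∈ convexHull ℝ {q : E × ℝ | g q.1 ≤ q.2} := by
  set D := convexHull ℝ {q : E × ℝ | g q.1 ≤ q.2} with hD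
  have hne : ∀ y, {s : ℝ | (y, s) ∈ D}.Nonempty := fun y =>
    ⟨g y, subset_convexHull ℝ _ (by simp)⟩
  have hbdd : ∀ y, BddBelow {s : ℝ | (y, s) ∈ D} := fun y => by
    refine ⟨c, fun s hs => ?_⟩
    exact affine_le_of_mem_convexHull_epigraph (S := univ) (l := AffineMap.const ℝ E c)
      (fun y _ => hc y) (by simpa using hs)
  let G : E → ℝ := fun y => sInf {s : ℝ | (y, s) ∈ D}
  have hGg : ∀ y, G y ≤ g y := fun y => csInf_le (hbdd y) (subset_convexHull ℝ _ (by simp))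
  have hG : ConvexOn ℝ univ G := by
    refine ⟨convex_univ, fun y _ z _ α β hα hβ hαβ => ?_⟩
    refine le_of_forall_pos_le_add fun δ hδ => ?_
    obtain ⟨s, hs, hs'⟩ := exists_lt_of_csInf_lt (hne y) (lt_add_of_pos_right (G y) hδ)
    obtain ⟨t, ht, ht'⟩ := exists_lt_of_csInf_lt (hne z) (lt_add_of_pos_right (G z) hδ)
    have hmem : (α • y + β • z, α * s + β * t) ∈ D := by
      simpa using convex_convexHull ℝ _ hs ht hα hβ hαβ
    calc G (α • y + β • z) ≤ α * s + β * t := csInf_le (hbdd _) hmem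
      _ ≤ α * (G y + δ) + β * (G z + δ) := by gcongr
      _ = α • G y + β • G z + δ := by
        simp only [smul_eq_mul]; linear_combination δ * hαβ
  have hcont : Continuous G := hG.locallyLipschitz.continuous
  obtain ⟨l, k, hl, hlx⟩ := hG.exists_affine_le_of_lt (𝕜 := ℝ) (mem_univ x)
    (sub_lt_self (G x) (half_pos hε)) isClosed_univ
    (hcont.lowerSemicontinuous.lowerSemicontinuousOn _)
  have hle : G x - ε / 2 ≤ convEnv g x := by
    refine le_csSup (bddAbove_affine_minorants g x)
      ⟨l.toLinearMap.toAffineMap + AffineMap.const ℝ E k, fun y => ?_, ?_⟩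
    · have := hl ⟨y, mem_univ y⟩
      exact le_trans (by simpa using this) (hGg y)
    · simpa using hlx.symm
  obtain ⟨s, hs, hs'⟩ := exists_lt_of_csInf_lt (hne x) (lt_add_of_pos_right (G x) (half_pos hε))
  exact ⟨s, by linarith, hs⟩

/-- If `S` contains the complement of a ball, and `g` is at most `m` on the bounding sphere and
at least `m` off `S`, then the convex hull of the epigraph of `g` is generated by the
points above `S`. -/
lemma convexHull_epigraph_subset [Nontrivial E] {g : E → ℝ} {S : Set E} {R m : ℝ} (hR : 0 ≤ R)
    (hball : (ball 0 R)ᶜ ⊆ S) (hm : ∀ y ∈ sphere (0 : E) R, g y ≤ m)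
    (hS : ∀ y ∉ S, m ≤ g y) :
    convexHull ℝ {q : E × ℝ | g q.1 ≤ q.2} ⊆
      convexHull ℝ {q : E × ℝ | q.1 ∈ S ∧ g q.1 ≤ q.2} := by
  have hsphere : sphere 0 R ⊆ S := fun y hy => hball (by simp [mem_sphere_zero_iff_norm.1 hy])
  refine convexHull_min ?_ (convex_convexHull ℝ _)
  rintro ⟨y, s⟩ hys
  by_cases hy : y ∈ S
  · exact subset_convexHull ℝ _ ⟨hy, hys⟩
  · have hyR : y ∈ closedBall (0 : E) R := by
      by_contra h
      exact hy (hball fun h' => h (ball_subset_closedBall h'))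
    have hsub : sphere (0 : E) R ×ˢ {s} ⊆ {q : E × ℝ | q.1 ∈ S ∧ g q.1 ≤ q.2} := by
      rintro ⟨z, t⟩ ⟨hz, rfl⟩
      exact ⟨hsphere hz, (hm z hz).trans ((hS y hy).trans hys)⟩
    refine convexHull_mono hsub ?_
    rw [convexHull_prod, convexHull_sphere_eq_closedBall _ hR, convexHull_singleton]
    exact ⟨hyR, rfl⟩

end ConvexEnvelope

lemma sq_sum_mul_norm_sub_le [SeminormedAddCommGroup E] {ι : Type} [Fintype ι] {w : ι → ℝ}
    (z : ι → E) (x : E) (hw₀ : ∀ i, 0 ≤ w i) (hw₁ : ∑ i, w i = 1) :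
    (∑ i, w i * ‖z i - x‖) ^ 2 ≤ ∑ i, w i * ‖z i - x‖ ^ 2 := by
  simpa using (even_two.convexOn_pow (𝕜 := ℝ)).map_sum_le (t := Finset.univ) (w := w)
    (p := fun i => ‖z i - x‖) (fun i _ => hw₀ i) hw₁ (by simp)

section InnerProduct

variable [NormedAddCommGroup E] [InnerProductSpace ℝ E]

lemma sum_mul_norm_sub_sq {ι : Type} [Fintype ι] {w : ι → ℝ} {z : ι → E} {x : E}
    (hw₁ : ∑ i, w i = 1) (hx : ∑ i, w i • z i = x) :
    ∑ i, w i * ‖z i - x‖ ^ 2 = ∑ i, w i * ‖z i‖ ^ 2 - ‖x‖ ^ 2 := by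
  have hinner : ∑ i, w i * inner ℝ (z i) x = ‖x‖ ^ 2 := by
    rw [← real_inner_self_eq_norm_sq]
    nth_rewrite 2 [← hx]
    simp [sum_inner, real_inner_smul_left]
  calc ∑ i, w i * ‖z i - x‖ ^ 2
      = ∑ i, (w i * ‖z i‖ ^ 2 - 2 * (w i * inner ℝ (z i) x) + w i * ‖x‖ ^ 2) := by
        refine Finset.sum_congr rfl fun i _ => ?_
        rw [norm_sub_sq_real]; ring
    _ = _ := by
        rw [Finset.sum_add_distrib, Finset.sum_sub_distrib, ← Finset.mul_sum, ← Finset.sum_mul,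
          hinner, hw₁]
        ring

end InnerProduct

lemma neg_le_mul_norm_sq_add_extendBy [SeminormedAddCommGroup E] {f : E → ℝ} {lam A M : ℝ}
    (hlam : 0 ≤ lam) (hf : ∀ y, |f y| ≤ A) (hAM : A ≤ M) (S : Set E) (y : E) :
    -M ≤ lam * ‖y‖ ^ 2 + extendBy f S M y := by
  have hsq : 0 ≤ lam * ‖y‖ ^ 2 := by positivity
  have hy := abs_le.1 (hf y)
  unfold extendBy
  split_ifs <;> linarith

lemma extendBy_neg (f : E → ℝ) (S : Set E) (M : ℝ) (y : E) :
    extendBy (fun y => -f y) S M y = -extendBy f S (-M) y := by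
  unfold extendBy
  split_ifs <;> simp

lemma neg_le_mul_norm_sq_sub_extendBy [SeminormedAddCommGroup E] {f : E → ℝ} {lam A M : ℝ}
    (hlam : 0 ≤ lam) (hf : ∀ y, |f y| ≤ A) (hAM : A ≤ M) (S : Set E) (y : E) :
    -M ≤ lam * ‖y‖ ^ 2 - extendBy f S (-M) y := by
  rw [sub_eq_add_neg, ← extendBy_neg]
  exact neg_le_mul_norm_sq_add_extendBy hlam (fun y => (abs_neg (f y)).trans_le (hf y)) hAM S y

lemma avgApprox_neg [NormedAddCommGroup E] [NormedSpace ℝ E] (lam M : ℝ) (f : E → ℝ) (S : Set E)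
    (x : E) : avgApprox lam M (fun y => -f y) S x = -avgApprox lam M f S x := by
  simp only [avgApprox, lowerTransform, upperTransform, extendBy_neg, neg_neg, sub_neg_eq_add,
    ← sub_eq_add_neg]
  ring

/-- Solves the quadratic inequality controlling the mean distance of a near-optimal family. -/
lemma le_of_quadratic_bound {lam a b ρ t : ℝ} (hlam : 0 < lam) (ha : 0 ≤ a) (hb : 0 ≤ b)
    (hρ : 0 ≤ ρ) (h : lam * t ^ 2 ≤ lam * ρ ^ 2 + a * (t + ρ) + b) :
    t ≤ ρ + a / lam + Real.sqrt (b / lam) := by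
  have hs := Real.sq_sqrt (div_nonneg hb hlam.le)
  have hs0 := Real.sqrt_nonneg (b / lam)
  set s := Real.sqrt (b / lam)
  set p := a / lam with hp
  have hp0 : 0 ≤ p := div_nonneg ha hlam.le
  have hap : a = p * lam := by rw [hp]; field_simp
  have hbs : b = s ^ 2 * lam := by rw [hs]; field_simp
  rw [hap, hbs] at h
  have h' : t ^ 2 ≤ ρ ^ 2 + p * (t + ρ) + s ^ 2 :=
    le_of_mul_le_mul_left (by linarith) hlam
  by_contra! hlt
  have h1 : s < t - ρ - p := by linarith
  nlinarith [mul_pos (show 0 < t + ρ by linarith [hs0]) (sub_pos.2 h1), mul_nonneg hs0 hρ,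
    mul_nonneg hs0 hp0]

section Estimate

variable [NormedAddCommGroup E] [InnerProductSpace ℝ E]

lemma convEnv_sub_le_of_mem_convexHull {f : E → ℝ} {K S : Set E} (hKS : K ⊆ S) {lam A M ρ : ℝ}
    (hlam : 0 < lam) (hf : ∀ y, |f y| ≤ A) (hAM : A ≤ M) {ω : ℝ → ℝ}
    (hωmono : MonotoneOn ω (Ici 0)) (hωmod : ∀ x y : E, |f x - f y| ≤ ω (dist x y))
    (hρ : 0 ≤ ρ) {x : E} (hx : x ∈ convexHull ℝ (closedBall x ρ ∩ K)) :
    convEnv (fun y => lam * ‖y‖ ^ 2 - extendBy f S (-M) y) x - lam * ‖x‖ ^ 2 ≤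
      lam * ρ ^ 2 + ω ρ - f x := by
  have hbd := neg_le_mul_norm_sq_sub_extendBy hlam.le hf hAM S
  obtain ⟨ι, _, w, z, hw₀, hw₁, hz, hzx⟩ := mem_convexHull_iff_exists_fintype.1 hx
  have hle := convEnv_le_sum (z := z) hbd hw₀ hw₁
  rw [hzx] at hle
  have hvar := sum_mul_norm_sub_sq hw₁ hzx
  have hsplit : ∑ i, w i * (lam * ‖z i‖ ^ 2 - extendBy f S (-M) (z i)) =
      lam * ∑ i, w i * ‖z i‖ ^ 2 - ∑ i, w i * f (z i) := by
    rw [Finset.mul_sum, ← Finset.sum_sub_distrib]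
    refine Finset.sum_congr rfl fun i _ => ?_
    rw [extendBy, if_pos (hKS (hz i).2)]; ring
  have hbound : lam * ∑ i, w i * ‖z i - x‖ ^ 2 - ∑ i, w i * f (z i) ≤
      ∑ i, w i * (lam * ρ ^ 2 + ω ρ - f x) := by
    rw [Finset.mul_sum, ← Finset.sum_sub_distrib]
    refine Finset.sum_le_sum fun i _ => ?_
    have hd : dist (z i) x ≤ ρ := (hz i).1
    have h1 : ‖z i - x‖ ^ 2 ≤ ρ ^ 2 := by
      rw [← dist_eq_norm]; gcongr
    have h2 : f x - f (z i) ≤ ω ρ :=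
      (le_abs_self _).trans ((hωmod _ _).trans
        (hωmono dist_nonneg hρ (by rwa [dist_comm])))
    have h3 : lam * ‖z i - x‖ ^ 2 - f (z i) ≤ lam * ρ ^ 2 + ω ρ - f x := by
      have := mul_le_mul_of_nonneg_left h1 hlam.le
      linarith
    calc lam * (w i * ‖z i - x‖ ^ 2) - w i * f (z i)
        = w i * (lam * ‖z i - x‖ ^ 2 - f (z i)) := by ring
      _ ≤ _ := mul_le_mul_of_nonneg_left h3 (hw₀ i)
  rw [← Finset.sum_mul, hw₁, one_mul, hvar] at hbound
  rw [hsplit] at hle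
  linarith

lemma avgApprox_le_add [FiniteDimensional ℝ E] [Nontrivial E] {f : E → ℝ} {K S : Set E}
    (hKS : K ⊆ S) {R : ℝ} (hR : 0 ≤ R) (hRS : (ball 0 R)ᶜ ⊆ S) {lam A M ρ : ℝ}
    (hlam : 0 < lam) (hf : ∀ y, |f y| ≤ A) (hM : A + lam * R ^ 2 ≤ M)
    {ω : ℝ → ℝ} (hωconc : ConcaveOn ℝ (Ici 0) ω)
    (hωmono : MonotoneOn ω (Ici 0)) (hωmod : ∀ x y : E, |f x - f y| ≤ ω (dist x y))
    {a b : ℝ} (ha : 0 ≤ a) (hb : 0 ≤ b) (hωlin : ∀ t, 0 ≤ t → ω t ≤ a * t + b)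
    (hρ : 0 ≤ ρ) {x : E} (hx : x ∈ convexHull ℝ (closedBall x ρ ∩ K)) {ε : ℝ} (hε : 0 < ε) :
    avgApprox lam M f S x ≤
      f x + ω (ρ + a / lam + Real.sqrt ((2 * b + ε) / lam)) + ε := by
  have hAM : A ≤ M := le_trans (by have : 0 ≤ lam * R ^ 2 := by positivity
                                   linarith) hM
  have hbd := neg_le_mul_norm_sq_sub_extendBy hlam.le hf hAM S
  have hbd' := neg_le_mul_norm_sq_add_extendBy hlam.le hf hAM S
  have hsphere : sphere 0 R ⊆ S := fun y hy => hRS (by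
    rw [mem_sphere] at hy; simp [hy])
  obtain ⟨s, hs, hmem⟩ := exists_mem_convexHull_lt_convEnv_add hbd x hε
  have hmem' := convexHull_epigraph_subset
    (g := fun y => lam * ‖y‖ ^ 2 - extendBy f S (-M) y) (m := M) hR hRS (fun y hy => by
      have hyR : ‖y‖ = R := by simpa using hy
      simp only [extendBy, if_pos (hsphere hy), hyR]
      linarith [neg_abs_le (f y), hf y]) (fun y hy => by
      simp only [extendBy, if_neg hy]
      have : 0 ≤ lam * ‖y‖ ^ 2 := by positivity
      linarith) hmem
  obtain ⟨ι, _, w, q, hw₀, hw₁, hq, hqx⟩ := mem_convexHull_iff_exists_fintype.1 hmem'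
  have hzx : ∑ i, w i • (q i).1 = x := by
    simpa [Prod.fst_sum] using congrArg Prod.fst hqx
  have hsum : ∑ i, w i * (q i).2 = s := by
    simpa [Prod.snd_sum] using congrArg Prod.snd hqx
  set z : ι → E := fun i => (q i).1 with hz
  have hvar := sum_mul_norm_sub_sq (z := z) hw₁ hzx
  have hupper : lam * ∑ i, w i * ‖z i‖ ^ 2 - ∑ i, w i * f (z i) ≤ s := by
    rw [← hsum, Finset.mul_sum, ← Finset.sum_sub_distrib]
    refine Finset.sum_le_sum fun i _ => ?_
    have h := (hq i).2
    rw [extendBy, if_pos (hq i).1] at h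
    calc lam * (w i * ‖z i‖ ^ 2) - w i * f (z i) = w i * (lam * ‖z i‖ ^ 2 - f (z i)) := by ring
      _ ≤ _ := mul_le_mul_of_nonneg_left h (hw₀ i)
  have hlower : convEnv (fun y => lam * ‖y‖ ^ 2 + extendBy f S M y) x ≤
      lam * ∑ i, w i * ‖z i‖ ^ 2 + ∑ i, w i * f (z i) := by
    have h := convEnv_le_sum (z := z) hbd' hw₀ hw₁
    rw [hzx] at h
    refine h.trans_eq ?_
    rw [Finset.mul_sum, ← Finset.sum_add_distrib]
    refine Finset.sum_congr rfl fun i _ => ?_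
    rw [extendBy, if_pos (hq i).1]; ring
  set t := ∑ i, w i * ‖z i - x‖ with ht
  have ht0 : 0 ≤ t := Finset.sum_nonneg fun i _ => mul_nonneg (hw₀ i) (norm_nonneg _)
  have hmean : ∑ i, w i * f (z i) ≤ f x + ω t := by
    have hjensen : ∑ i, w i * ω ‖z i - x‖ ≤ ω t := by
      simpa using hωconc.le_map_sum (t := Finset.univ) (w := w)
        (p := fun i => ‖z i - x‖) (fun i _ => hw₀ i) hw₁ (fun i _ => norm_nonneg _)
    have hpt : ∑ i, w i * f (z i) ≤ ∑ i, (w i * f x + w i * ω ‖z i - x‖) := by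
      refine Finset.sum_le_sum fun i _ => ?_
      rw [← mul_add]
      refine mul_le_mul_of_nonneg_left ?_ (hw₀ i)
      rw [← dist_eq_norm]
      linarith [le_abs_self (f (z i) - f x), hωmod (z i) x]
    rw [Finset.sum_add_distrib, ← Finset.sum_mul, hw₁, one_mul] at hpt
    linarith
  have hK := convEnv_sub_le_of_mem_convexHull hKS hlam hf hAM hωmono hωmod hρ hx
  have htsq : lam * t ^ 2 ≤ lam * ∑ i, w i * ‖z i - x‖ ^ 2 :=
    mul_le_mul_of_nonneg_left (sq_sum_mul_norm_sub_le z x hw₀ hw₁) hlam.le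
  rw [hvar] at htsq
  have htle : t ≤ ρ + a / lam + Real.sqrt ((2 * b + ε) / lam) := by
    refine le_of_quadratic_bound hlam ha (by positivity) hρ ?_
    have := hωlin t ht0
    have := hωlin ρ hρ
    linarith
  have hωt : ω t ≤ ω (ρ + a / lam + Real.sqrt ((2 * b + ε) / lam)) :=
    hωmono ht0 (ht0.trans htle) htle
  unfold avgApprox lowerTransform upperTransform
  linarith

end Estimate

/-- Passage to the limit in the error bound. If the limiting argument is `0`, then `a = b = 0` and
`ω` vanishes; otherwise `ω` is continuous there by concavity. -/
lemma le_modulus_of_forall_pos {ω : ℝ → ℝ} (hωconc : ConcaveOn ℝ (Ici 0) ω)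
    (hωmono : MonotoneOn ω (Ici 0))
    (hω0 : ω 0 = 0) {a b lam ρ v : ℝ} (ha : 0 ≤ a) (hb : 0 ≤ b)
    (hωlin : ∀ t, 0 ≤ t → ω t ≤ a * t + b) (hlam : 0 < lam) (hρ : 0 ≤ ρ)
    (h : ∀ ε > 0, ∃ σ, ρ ≤ σ ∧ σ ≤ ρ + ε ∧
      v ≤ ω (σ + a / lam + Real.sqrt ((2 * b + ε) / lam)) + ε) :
    v ≤ ω (ρ + a / lam + Real.sqrt (2 * b / lam)) := by
  have hal : 0 ≤ a / lam := div_nonneg ha hlam.le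
  have hbl : 0 ≤ Real.sqrt (2 * b / lam) := Real.sqrt_nonneg _
  let τ : ℝ → ℝ := fun ε => (ρ + ε) + a / lam + Real.sqrt ((2 * b + ε) / lam)
  have hv : ∀ ε > 0, v ≤ ω (τ ε) + ε := fun ε hε => by
    obtain ⟨σ, h1, h2, h3⟩ := h ε hε
    have hsq := Real.sqrt_nonneg ((2 * b + ε) / lam)
    have := hωmono (a := σ + a / lam + Real.sqrt ((2 * b + ε) / lam)) (b := τ ε)
      (mem_Ici.2 (by linarith)) (mem_Ici.2 (by simp only [τ]; linarith))
      (by simp only [τ]; linarith)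
    linarith
  have hτ0 : τ 0 = ρ + a / lam + Real.sqrt (2 * b / lam) := by simp [τ]
  rw [← hτ0]
  have hτnn : 0 ≤ τ 0 := by rw [hτ0]; positivity
  rcases hτnn.eq_or_lt with hzero | hpos
  · have ha0 : a = 0 := by
      have : a / lam = 0 := by rw [hτ0] at hzero; linarith
      simpa [hlam.ne'] using this
    have hb0 : b = 0 := by
      have : Real.sqrt (2 * b / lam) = 0 := by rw [hτ0] at hzero; linarith
      rw [Real.sqrt_eq_zero (by positivity)] at this
      simpa [hlam.ne'] using this
    rw [← hzero, hω0]
    refine le_of_forall_pos_le_add fun ε hε => ?_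
    have hτε : 0 ≤ τ ε := by simp only [τ]; positivity
    have := hωlin _ hτε
    rw [ha0, hb0] at this
    linarith [hv ε hε]
  · have hω : ContinuousAt ω (τ 0) := by
      have := hωconc.continuousOn_interior
      rw [interior_Ici] at this
      exact this.continuousAt (Ioi_mem_nhds hpos)
    have hcont : ContinuousAt (fun ε => ω (τ ε) + ε) 0 := by
      refine ContinuousAt.add (ContinuousAt.comp (f := τ) hω ?_) continuousAt_id
      exact Continuous.continuousAt (by fun_prop)
    have htend : Filter.Tendsto (fun ε => ω (τ ε) + ε) (nhdsWithin 0 (Ioi 0))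
        (nhds (ω (τ 0))) := by
      simpa using hcont.tendsto.mono_left nhdsWithin_le_nhds
    exact ge_of_tendsto htend (Filter.eventually_of_mem self_mem_nhdsWithin hv)

/-- **Inpainting error estimate (uniformly continuous case).** -/
theorem inpainting_error_estimate_uc {n : ℕ}
    (Λ : Set (EuclideanSpace ℝ (Fin n))) (hΛconv : Convex ℝ Λ) (hΛcpt : IsCompact Λ)
    (Ω : Set (EuclideanSpace ℝ (Fin n))) (hΩsub : Ω ⊆ Λ) (hΩne : Ω.Nonempty)
    (hΩopen : IsOpen Ω)
    (K : Set (EuclideanSpace ℝ (Fin n))) (hK : K = Λ \ Ω)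
    (f : EuclideanSpace ℝ (Fin n) → ℝ)
    (hfbd : ∃ C : ℝ, ∀ x ∈ Λ, |f x| ≤ C) (hfuc : UniformContinuousOn f Λ)
    (ftil : EuclideanSpace ℝ (Fin n) → ℝ)
    (hext : ∀ x ∈ Λ, ftil x = f x) (hftiluc : UniformContinuous ftil)
    (A0 : ℝ) (hA0 : ∀ x, |ftil x| ≤ A0)
    (c0 r : ℝ) (hr : 0 < r)
    (hc0 : ∀ x : EuclideanSpace ℝ (Fin n), r ≤ ‖x‖ → ftil x = c0)
    (hKr : K ⊆ Metric.ball 0 r)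
    (R : ℝ) (hR : r < R)
    (ω : ℝ → ℝ) (hωconc : ConcaveOn ℝ (Set.Ici 0) ω) (hωmono : MonotoneOn ω (Set.Ici 0))
    (hω0 : ω 0 = 0)
    (hωmod : ∀ x y : EuclideanSpace ℝ (Fin n), |ftil x - ftil y| ≤ ω (dist x y))
    (a b : ℝ) (ha : 0 ≤ a) (hb : 0 ≤ b) (hωlin : ∀ t : ℝ, 0 ≤ t → ω t ≤ a * t + b)
    (lam M : ℝ) (hlam : 0 < lam) (hM : A0 + lam * (R + r) ^ 2 < M) :
    ∀ x ∈ convexHull ℝ K,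
      |avgApprox lam M ftil (K ∪ (Metric.ball 0 R)ᶜ) x - ftil x| ≤
        ω (convexDensityRadius K x + a / lam + Real.sqrt (2 * b / lam)) := by
  intro x hx
  have hKne : K.Nonempty := convexHull_nonempty_iff.1 ⟨x, hx⟩
  have : Nontrivial (EuclideanSpace ℝ (Fin n)) := by
    obtain ⟨z, hz⟩ := hΩne
    obtain ⟨k, hk⟩ := hKne
    refine ⟨z, k, ?_⟩
    rintro rfl
    rw [hK] at hk
    exact hk.2 hz
  have hne : {s : ℝ | 0 ≤ s ∧ x ∈ convexHull ℝ (closedBall x s ∩ K)}.Nonempty := by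
    refine ⟨‖x‖ + r, by positivity, ?_⟩
    rwa [inter_eq_right.2]
    refine hKr.trans (ball_subset_closedBall.trans (closedBall_subset_closedBall' ?_))
    simp [add_comm]
  have hM' : A0 + lam * R ^ 2 ≤ M := by
    have : lam * R ^ 2 ≤ lam * (R + r) ^ 2 := by
      have hR0 : 0 ≤ R := hr.le.trans hR.le
      gcongr
      linarith
    linarith
  have upper : ∀ g : EuclideanSpace ℝ (Fin n) → ℝ, (∀ y, |g y| ≤ A0) →
      (∀ y z, |g y - g z| ≤ ω (dist y z)) →
      avgApprox lam M g (K ∪ (ball 0 R)ᶜ) x - g x ≤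
        ω (convexDensityRadius K x + a / lam + Real.sqrt (2 * b / lam)) := by
    intro g hg hgmod
    refine le_modulus_of_forall_pos hωconc hωmono hω0 ha hb hωlin hlam
      (Real.sInf_nonneg fun s hs => hs.1) fun ε hε => ?_
    obtain ⟨σ, hσ, hσlt⟩ := exists_lt_of_csInf_lt hne
      (lt_add_of_pos_right (convexDensityRadius K x) hε)
    refine ⟨σ, csInf_le ⟨0, fun s hs => hs.1⟩ hσ, hσlt.le, ?_⟩
    have := avgApprox_le_add (S := K ∪ (ball 0 R)ᶜ) subset_union_left (hr.le.trans hR.le)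
      subset_union_right hlam hg hM' hωconc hωmono hgmod ha hb hωlin hσ.1 hσ.2 hε
    linarith
  rw [abs_le']
  refine ⟨upper ftil hA0 hωmod, ?_⟩
  have h := upper (fun y => -ftil y) (by simpa using hA0) (fun y z => by
    rw [neg_sub_neg, abs_sub_comm]; exact hωmod y z)
  rw [avgApprox_neg] at h
  linarith
end
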